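/- arXiv:1807.10881 — 6 statements merged into one kernel-verified Lean document; each statement's English description precedes it below -/
import Mathlib

section
/- Let M ≥ 3 be an integer, A, C real numbers, and B_1, …, B_{M−1} real numbers. Define doubly indexed reals λ_n^{(k)} for 1 ≤ n ≤ M and 1 ≤ k ≤ M by: λ_1^{(k)} = 1 for all k, and for 1 ≤ n ≤ M−1, λ_{n+1}^{(k)} = A·λ_n^{(k+1)} + B_n for 1 ≤ k ≤ M−1, and λ_{n+1}^{(M)} = C·λ_n^{(1)} + B_n. Then for every k with 2 ≤ k ≤ M−1, λ_M^{(k)} − λ_M^{(k+1)} = (A − C)·A^{M−k−1}·B_{k−1}. -/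
/-- Without wrap-around, differences of neighbouring entries of the recursion
`lam (n + 1) k = A * lam n (k + 1) + B n` are shifted and scaled by `A` at each step. -/
theorem sub_succ_eq_pow_mul_sub_succ {M : ℕ} {A : ℝ} {B : ℕ → ℝ} {lam : ℕ → ℕ → ℝ}
    (hrec : ∀ n, 1 ≤ n → n ≤ M - 1 →
      ∀ k, 1 ≤ k → k ≤ M - 1 → lam (n + 1) k = A * lam n (k + 1) + B n)
    {n : ℕ} (hn : 1 ≤ n) (j i : ℕ) (hi : 1 ≤ i) (hij : i + 1 + j ≤ M) (hnj : n + j ≤ M) :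
    lam (n + j) i - lam (n + j) (i + 1) = A ^ j * (lam n (i + j) - lam n (i + j + 1)) := by
  induction j generalizing i with
  | zero => simp
  | succ j ih =>
    have h := ih (i + 1) (by omega) (by omega) (by omega)
    rw [show i + 1 + j = i + (j + 1) by omega] at h
    rw [← add_assoc n j 1, hrec (n + j) (by omega) (by omega) i hi (by omega),
      hrec (n + j) (by omega) (by omega) (i + 1) (by omega) (by omega), pow_succ]
    linear_combination A * h

/-- Telescoping identity for the eigenvalue recursion with fixed `A`, `C` and varying offsets
`B_n`, started from all eigenvalues equal to `1`: for `2 ≤ k ≤ M−1`,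
`λ_M^{(k)} − λ_M^{(k+1)} = (A − C)·A^{M−k−1}·B_{k−1}`. -/
theorem stmt_6 (M : ℕ) (hM : 3 ≤ M) (A C : ℝ) (B : ℕ → ℝ) (lam : ℕ → ℕ → ℝ)
    (h1 : ∀ k, 1 ≤ k → k ≤ M → lam 1 k = 1)
    (hrec : ∀ n, 1 ≤ n → n ≤ M - 1 →
      (∀ k, 1 ≤ k → k ≤ M - 1 → lam (n + 1) k = A * lam n (k + 1) + B n) ∧
      lam (n + 1) M = C * lam n 1 + B n)
    (k : ℕ) (hk1 : 2 ≤ k) (hk2 : k ≤ M - 1) :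
    lam M k - lam M (k + 1) = (A - C) * A ^ (M - k - 1) * B (k - 1) := by
  have hshift := fun n hn hn' => (hrec n hn hn').1
  have hwrap := fun n hn hn' => (hrec n hn hn').2
  obtain ⟨m, rfl⟩ : ∃ m, k = m + 2 := ⟨k - 2, by omega⟩
  obtain ⟨j, rfl⟩ : ∃ j, M = m + 3 + j := ⟨M - (m + 3), by omega⟩
  have hlow := sub_succ_eq_pow_mul_sub_succ hshift le_rfl m 1 le_rfl (by omega) (by omega)
  rw [h1 (1 + m) (by omega) (by omega), h1 (1 + m + 1) (by omega) (by omega), add_comm 1 m]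
    at hlow
  have htop := sub_succ_eq_pow_mul_sub_succ hshift (n := m + 3) (by omega) j (m + 2)
    (by omega) (by omega) le_rfl
  have e1 := hshift (m + 2) (by omega) (by omega) (m + 2 + j) (by omega) (by omega)
  have e2 := hwrap (m + 2) (by omega) (by omega)
  have e3 := hwrap (m + 1) (by omega) (by omega)
  have e4 := hshift (m + 1) (by omega) (by omega) 1 le_rfl (by omega)
  rw [show m + 2 + j + 1 = m + 3 + j by omega] at e1 htop
  rw [show m + 3 + j - (m + 2) - 1 = j by omega, show m + 2 - 1 = m + 1 by omega, htop, e1, e2,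
    e3, e4]
  linear_combination A ^ j * A * C * hlow
end

section
/- Let a > 0, P > 0, and ρ ∈ (0, ρ₀], where ρ₀ = sqrt((a²P² + P − sqrt(P(2a²P² + P)))/(a²P²)). Then the quadratic equation (2aP + 2Pρ + 2a²Pρ + ρ + 2aPρ²)·b² − 2(2Pρ + aP + aPρ²)·b + 2Pρ = 0 has two real roots b₁* = ((2Pρ + aP + aPρ²) + sqrt(Δ))/(2aP + 2Pρ + 2a²Pρ + ρ + 2aPρ²) and b₂* = ((2Pρ + aP + aPρ²) − sqrt(Δ))/(2aP + 2Pρ + 2a²Pρ + ρ + 2aPρ²), where Δ = a²P²ρ⁴ − 2(a²P² + P)ρ² + a²P² ≥ 0, and both roots are strictly positive. -/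
/-- The polynomial `a²P²ρ⁴ − 2(a²P² + P)ρ² + a²P²` is nonnegative up to its smallest positive
root. -/
lemma discrim_nonneg {a P ρ : ℝ} (ha : 0 < a) (hP : 0 < P) (hρ : 0 < ρ)
    (hle : ρ ≤ √((a ^ 2 * P ^ 2 + P - √(P * (2 * a ^ 2 * P ^ 2 + P))) / (a ^ 2 * P ^ 2))) :
    0 ≤ a ^ 2 * P ^ 2 * ρ ^ 4 - 2 * (a ^ 2 * P ^ 2 + P) * ρ ^ 2 + a ^ 2 * P ^ 2 := by
  have hc : 0 < a ^ 2 * P ^ 2 := by positivity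
  have hs : √(P * (2 * a ^ 2 * P ^ 2 + P)) ^ 2 = P * (2 * a ^ 2 * P ^ 2 + P) :=
    Real.sq_sqrt (by positivity)
  have hle' := (Real.le_sqrt' hρ).1 hle
  rw [le_div_iff₀ hc] at hle'
  have hle_sq : √(P * (2 * a ^ 2 * P ^ 2 + P)) ^ 2 ≤
      (a ^ 2 * P ^ 2 + P - ρ ^ 2 * (a ^ 2 * P ^ 2)) ^ 2 :=
    pow_le_pow_left₀ (Real.sqrt_nonneg _) (by linarith) 2
  rw [hs] at hle_sq
  refine nonneg_of_mul_nonneg_right ?_ hc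
  linear_combination hle_sq

/-- The quadratic formula for `A b² − 2 B b + C`, with `s` a square root of `B² − A C`. -/
lemma quadratic_eq_zero_of_sq_eq {A B C s : ℝ} (hA : A ≠ 0) (hs : s ^ 2 = B ^ 2 - A * C) :
    A * ((B + s) / A) ^ 2 - 2 * B * ((B + s) / A) + C = 0 := by
  field_simp
  linear_combination hs

/-- For `ρ ∈ (0, ρ₀]`, the quadratic
`(2aP + 2Pρ + 2a²Pρ + ρ + 2aPρ²)·b² − 2(2Pρ + aP + aPρ²)·b + 2Pρ = 0` has the two real,
strictly positive roots `b₁*` and `b₂*` given by the quadratic formula with discriminant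
`Δ = a²P²ρ⁴ − 2(a²P² + P)ρ² + a²P² ≥ 0`. -/
theorem stmt_10 (a P ρ : ℝ) (ha : 0 < a) (hP : 0 < P)
    (ρ₀ : ℝ)
    (hρ₀ : ρ₀ = Real.sqrt
      ((a ^ 2 * P ^ 2 + P - Real.sqrt (P * (2 * a ^ 2 * P ^ 2 + P))) / (a ^ 2 * P ^ 2)))
    (hρ : ρ ∈ Set.Ioc (0 : ℝ) ρ₀)
    (Δ : ℝ)
    (hΔ : Δ = a ^ 2 * P ^ 2 * ρ ^ 4 - 2 * (a ^ 2 * P ^ 2 + P) * ρ ^ 2 + a ^ 2 * P ^ 2)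
    (b₁ b₂ : ℝ)
    (hb₁ : b₁ = ((2 * P * ρ + a * P + a * P * ρ ^ 2) + Real.sqrt Δ) /
      (2 * a * P + 2 * P * ρ + 2 * a ^ 2 * P * ρ + ρ + 2 * a * P * ρ ^ 2))
    (hb₂ : b₂ = ((2 * P * ρ + a * P + a * P * ρ ^ 2) - Real.sqrt Δ) /
      (2 * a * P + 2 * P * ρ + 2 * a ^ 2 * P * ρ + ρ + 2 * a * P * ρ ^ 2)) :
    0 ≤ Δ ∧
    (2 * a * P + 2 * P * ρ + 2 * a ^ 2 * P * ρ + ρ + 2 * a * P * ρ ^ 2) * b₁ ^ 2 -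
      2 * (2 * P * ρ + a * P + a * P * ρ ^ 2) * b₁ + 2 * P * ρ = 0 ∧
    (2 * a * P + 2 * P * ρ + 2 * a ^ 2 * P * ρ + ρ + 2 * a * P * ρ ^ 2) * b₂ ^ 2 -
      2 * (2 * P * ρ + a * P + a * P * ρ ^ 2) * b₂ + 2 * P * ρ = 0 ∧
    0 < b₁ ∧ 0 < b₂ := by
  have hA : 0 < 2 * a * P + 2 * P * ρ + 2 * a ^ 2 * P * ρ + ρ + 2 * a * P * ρ ^ 2 := by
    have := hρ.1
    positivity
  have hΔ_nonneg : 0 ≤ Δ := hΔ ▸ discrim_nonneg ha hP hρ.1 (hρ₀ ▸ hρ.2)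
  have hB : 0 < 2 * P * ρ + a * P + a * P * ρ ^ 2 := by
    have := hρ.1
    positivity
  have hC : 0 < 2 * P * ρ := mul_pos (by positivity) hρ.1
  have hdiscrim : Δ = (2 * P * ρ + a * P + a * P * ρ ^ 2) ^ 2 -
      (2 * a * P + 2 * P * ρ + 2 * a ^ 2 * P * ρ + ρ + 2 * a * P * ρ ^ 2) * (2 * P * ρ) := by
    rw [hΔ]
    ring
  clear hΔ hρ₀
  generalize 2 * a * P + 2 * P * ρ + 2 * a ^ 2 * P * ρ + ρ + 2 * a * P * ρ ^ 2 = A at *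
  generalize 2 * P * ρ + a * P + a * P * ρ ^ 2 = B at *
  generalize 2 * P * ρ = C at *
  have hsq := Real.sq_sqrt hΔ_nonneg
  have hlt : √Δ < B := by
    rw [Real.sqrt_lt' hB, hdiscrim]
    linarith [mul_pos hA hC]
  refine ⟨hΔ_nonneg, ?_, ?_, ?_, ?_⟩
  · rw [hb₁]
    exact quadratic_eq_zero_of_sq_eq hA.ne' (hsq.trans hdiscrim)
  · rw [hb₂, sub_eq_add_neg B]
    exact quadratic_eq_zero_of_sq_eq hA.ne' ((neg_sq _).trans (hsq.trans hdiscrim))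
  · rw [hb₁]
    positivity
  · rw [hb₂]
    exact div_pos (sub_pos.2 hlt) hA
end

section
/- Let a > 0, P > 0, and suppose ρ ∈ (0,1) satisfies the quartic equation 2a³P²ρ⁴ + a²Pρ³ − 4aP(a²P + 1)ρ² − (2a²P + P + 2)ρ + 2aP(a²P + 1) = 0. Define b = P(1 + aρ)/(P(1 + a² + 2aρ) + 1) and β = sqrt((a²P(1 − ρ²) + 1)/(P(1 + a² + 2aρ) + 1)). Then the triple (b, β, ρ) satisfies both steady-state equations: P·β² = P − 2bP(1 + aρ) + b²(1 + P + a²P + 2aρP) and −ρ·β² = ρ − 2b(ρ + a) + b²(ρ(1 + a²) + 2a). -/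
/-- If `ρ ∈ (0,1)` solves the Kramer quartic, then the Kramer parameter choices
`b = P(1 + aρ)/(P(1 + a² + 2aρ) + 1)` and `β = sqrt((a²P(1 − ρ²) + 1)/(P(1 + a² + 2aρ) + 1))`
satisfy both steady-state equations of the two-user time-varying feedback code. -/
theorem stmt_13 (a P ρ : ℝ) (ha : 0 < a) (hP : 0 < P) (hρ : ρ ∈ Set.Ioo (0 : ℝ) 1)
    (hquartic : 2 * a ^ 3 * P ^ 2 * ρ ^ 4 + a ^ 2 * P * ρ ^ 3 -
      4 * a * P * (a ^ 2 * P + 1) * ρ ^ 2 - (2 * a ^ 2 * P + P + 2) * ρ +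
      2 * a * P * (a ^ 2 * P + 1) = 0)
    (b β : ℝ)
    (hb : b = P * (1 + a * ρ) / (P * (1 + a ^ 2 + 2 * a * ρ) + 1))
    (hβ : β = Real.sqrt ((a ^ 2 * P * (1 - ρ ^ 2) + 1) / (P * (1 + a ^ 2 + 2 * a * ρ) + 1))) :
    P * β ^ 2 = P - 2 * b * P * (1 + a * ρ) +
      b ^ 2 * (1 + P + a ^ 2 * P + 2 * a * ρ * P) ∧
    -ρ * β ^ 2 = ρ - 2 * b * (ρ + a) + b ^ 2 * (ρ * (1 + a ^ 2) + 2 * a) := by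
  obtain ⟨hρ0, hρ1⟩ := hρ
  have hD : 0 < P * (1 + a ^ 2 + 2 * a * ρ) + 1 := by positivity
  have hN : 0 ≤ a ^ 2 * P * (1 - ρ ^ 2) + 1 := by
    have : 0 ≤ 1 - ρ ^ 2 := by nlinarith
    positivity
  have hβ2 : β ^ 2 = (a ^ 2 * P * (1 - ρ ^ 2) + 1) / (P * (1 + a ^ 2 + 2 * a * ρ) + 1) := by
    rw [hβ, Real.sq_sqrt (div_nonneg hN hD.le)]
  have hD' := hD.ne'
  rw [hβ2, hb]
  constructor
  · field_simp
    ring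
  · field_simp
    linear_combination hquartic
end

section
/- For every a > 0 and P > 0, the quartic polynomial g(ρ) = 2a³P²ρ⁴ + a²Pρ³ − 4aP(a²P + 1)ρ² − (2a²P + P + 2)ρ + 2aP(a²P + 1) has exactly one root in the open interval (0, 1). -/
/-- A quartic `Aρ⁴ + Bρ³ - Cρ² - Dρ + E` with `A, B ≥ 0`, `E > 0` which is negative at `1` has
no two distinct roots in `(0, 1)`: dividing by `ρ` gives a strictly convex function. -/
theorem not_two_roots_of_quartic_neg_at_one {A B C D E x y : ℝ} (hA : 0 ≤ A) (hB : 0 ≤ B)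
    (hE : 0 < E) (h1 : A + B - C - D + E < 0) (hx : 0 < x) (hxy : x < y) (hy : y < 1)
    (hgx : A * x ^ 4 + B * x ^ 3 - C * x ^ 2 - D * x + E = 0)
    (hgy : A * y ^ 4 + B * y ^ 3 - C * y ^ 2 - D * y + E = 0) : False := by
  have hy0 : 0 < y := hx.trans hxy
  have hyx : 0 < y - x := sub_pos.2 hxy
  have hx1 : 0 < 1 - x := by linarith
  have hy1 : 0 < 1 - y := sub_pos.2 hy
  have hpos : 0 < (1 - x) * (1 - y) * (y - x) * (x * y * (A * (x + y + 1) + B) + E) := by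
    positivity
  have hneg : x * y * (y - x) * (A + B - C - D + E) < 0 :=
    mul_neg_of_pos_of_neg (by positivity) h1
  have key : x * y * (y - x) * (A + B - C - D + E) =
      (1 - x) * (1 - y) * (y - x) * (x * y * (A * (x + y + 1) + B) + E) := by
    linear_combination x * (1 - x) * hgy - y * (1 - y) * hgx
  linarith

/-- For every `a > 0` and `P > 0`, the quartic
`g(ρ) = 2a³P²ρ⁴ + a²Pρ³ − 4aP(a²P + 1)ρ² − (2a²P + P + 2)ρ + 2aP(a²P + 1)` has exactly one
root in the open interval `(0, 1)`. -/
theorem stmt_14 (a P : ℝ) (ha : 0 < a) (hP : 0 < P) :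
    ∃! ρ : ℝ, ρ ∈ Set.Ioo (0 : ℝ) 1 ∧
      2 * a ^ 3 * P ^ 2 * ρ ^ 4 + a ^ 2 * P * ρ ^ 3 -
        4 * a * P * (a ^ 2 * P + 1) * ρ ^ 2 - (2 * a ^ 2 * P + P + 2) * ρ +
        2 * a * P * (a ^ 2 * P + 1) = 0 := by
  have h1 : 2 * a ^ 3 * P ^ 2 + a ^ 2 * P - 4 * a * P * (a ^ 2 * P + 1) -
      (2 * a ^ 2 * P + P + 2) + 2 * a * P * (a ^ 2 * P + 1) < 0 := by
    have : 0 < a ^ 2 * P + 2 * a * P + P + 2 := by positivity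
    linarith
  have hE : 0 < 2 * a * P * (a ^ 2 * P + 1) := by positivity
  obtain ⟨x, hx, hgx⟩ : (0 : ℝ) ∈ (fun ρ : ℝ => 2 * a ^ 3 * P ^ 2 * ρ ^ 4 + a ^ 2 * P * ρ ^ 3 -
      4 * a * P * (a ^ 2 * P + 1) * ρ ^ 2 - (2 * a ^ 2 * P + P + 2) * ρ +
      2 * a * P * (a ^ 2 * P + 1)) '' Set.Ioo 0 1 := by
    refine intermediate_value_Ioo' zero_le_one (by fun_prop) ⟨?_, ?_⟩
    · simpa only [one_pow, mul_one] using h1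
    · norm_num
      positivity
  refine ⟨x, ⟨hx, hgx⟩, ?_⟩
  rintro y ⟨hy, hgy⟩
  rcases lt_trichotomy y x with h | h | h
  · exact (not_two_roots_of_quartic_neg_at_one (by positivity) (by positivity) hE h1
      hy.1 h hx.2 hgy hgx).elim
  · exact h
  · exact (not_two_roots_of_quartic_neg_at_one (by positivity) (by positivity) hE h1
      hx.1 h hy.2 hgx hgy).elim
end

section
/- Let P > 0, M ≥ 1 an integer, and 0 < λ < M. Define A = (PMλ + 1)/(Pλ(M − λ) + 1), B = Pλ²/((Pλ(M − λ) + 1)(PMλ + 1)), and C = 1/((Pλ(M − λ) + 1)(PMλ + 1)). Then A > 1, and the equation λ = C·A^{M−1}·λ + B·(A^M − 1)/(A − 1) holds if and only if (λ + 1/(PMλ + 1))·((Pλ(M − λ) + 1)/(PMλ + 1))^M = (λ + PMλ + 1)/(PMλ + 1)². -/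
/-- In the case `a = 1` with `0 < λ < M`, the recursion coefficients
`A = (PMλ + 1)/(Pλ(M − λ) + 1)`, `B = Pλ²/((Pλ(M − λ) + 1)(PMλ + 1))` and
`C = 1/((Pλ(M − λ) + 1)(PMλ + 1))` satisfy `A > 1`, and the fixed-point equation
`λ = CA^{M−1}λ + B(A^M − 1)/(A − 1)` holds iff
`(λ + 1/(PMλ + 1))((Pλ(M − λ) + 1)/(PMλ + 1))^M = (λ + PMλ + 1)/(PMλ + 1)²`. -/
theorem stmt_16 (P lam : ℝ) (M : ℕ) (hP : 0 < P) (hM : 1 ≤ M)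
    (hlam1 : 0 < lam) (hlam2 : lam < M)
    (A B C : ℝ)
    (hA : A = (P * (M : ℝ) * lam + 1) / (P * lam * ((M : ℝ) - lam) + 1))
    (hB : B = P * lam ^ 2 /
      ((P * lam * ((M : ℝ) - lam) + 1) * (P * (M : ℝ) * lam + 1)))
    (hC : C = 1 / ((P * lam * ((M : ℝ) - lam) + 1) * (P * (M : ℝ) * lam + 1))) :
    1 < A ∧
    (lam = C * A ^ (M - 1) * lam + B * (A ^ M - 1) / (A - 1) ↔
      (lam + 1 / (P * (M : ℝ) * lam + 1)) *
        ((P * lam * ((M : ℝ) - lam) + 1) / (P * (M : ℝ) * lam + 1)) ^ M =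
      (lam + P * (M : ℝ) * lam + 1) / (P * (M : ℝ) * lam + 1) ^ 2) := by
  have hMlam : 0 < (M : ℝ) - lam := sub_pos.mpr hlam2
  have hD : 0 < P * lam * ((M : ℝ) - lam) + 1 := by positivity
  have hS : 0 < P * (M : ℝ) * lam + 1 := by positivity
  have hSD : P * (M : ℝ) * lam + 1 = P * lam * ((M : ℝ) - lam) + 1 + P * lam ^ 2 := by ring
  have hlamS : lam + P * (M : ℝ) * lam + 1 = lam + (P * (M : ℝ) * lam + 1) := by ring
  rw [hlamS]
  generalize P * (M : ℝ) * lam + 1 = S at *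
  generalize P * lam * ((M : ℝ) - lam) + 1 = D at *
  have hPlam : 0 < P * lam ^ 2 := by positivity
  have hA1 : 1 < A := by
    rw [hA, one_lt_div hD]
    linarith
  refine ⟨hA1, ?_⟩
  have hApos : 0 < A ^ M := by positivity
  have hBA : B * (A ^ M - 1) / (A - 1) = (A ^ M - 1) / S := by
    have hAsub : A - 1 = P * lam ^ 2 / D := by
      rw [hA, div_sub_one hD.ne']
      congr 1
      linarith
    rw [hAsub, hB]
    field_simp
  have hCA : C * A ^ (M - 1) = A ^ M / S ^ 2 := by
    rw [← pow_sub_one_mul (by lia : M ≠ 0) A]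
    generalize A ^ (M - 1) = X
    rw [hC, hA]
    field_simp
  have hinv : (D / S) ^ M = (A ^ M)⁻¹ := by rw [hA, ← inv_pow, inv_div]
  rw [hBA, hCA, hinv]
  generalize A ^ M = X at *
  rw [← div_eq_mul_inv, div_eq_iff hApos.ne']
  have hsplit : (lam + S) / S ^ 2 * X = X / S ^ 2 * lam + X / S := by
    field_simp
  rw [hsplit, sub_div]
  constructor <;> intro h <;> linarith
end

section
/- Let M ≥ 2 be an integer, a a real number with a ∉ {0, 1}, P > 0, A > 1, and β > 0. Set b = (1 − β·√A)/(1 − a), and assume a·b·(2(1 − a)b + Mab − 2) ≠ 0. Define λ = (β²(1 − A) − b²/P)/(a b (2(1 − a)b + Mab − 2)), assume λ ≠ 0, and set B = b²/(P β²) and C = A + (M/λ)(1 − A − B). Define D_A = −M·A^{M−1} + (A^M − 1)/(A − 1), Y₀ = −(A^M − 1)(A − 1)/D_A, Y₁ = (M(A − 1)A^{M−1}/D_A)·2a, Y₂ = −(A^M − 1)/(P·D_A) − (M(A − 1)A^{M−1}/D_A)·a((M − 2)a + 2), and Z₄ = Y₀ + A·Y₂/(1 − a)² + a((M − 2)a +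 2)·A²/(P(1 − a)⁴), Z₃ = −4A^{3/2}·a((M − 2)a + 2)/(P(1 − a)⁴) + 2a·A^{3/2}/(P(1 − a)³) − 2Y₂·√A/(1 − a)² − Y₁·√A/(1 − a), Z₂ = 6A·a((M − 2)a + 2)/(P(1 − a)⁴) − 6A·a/(P(1 − a)³) + Y₂/(1 − a)² + Y₁/(1 − a), Z₁ = −4√A·a((M − 2)a + 2)/(P(1 − a)⁴) + 6√A·a/(P(1 − a)³), Z₀ = a((M − 2)a + 2)/(P(1 − a)⁴) − 2a/(P(1 − a)³). Then D_A ≠ 0, and the fixed-point equation (1 − C·A^{M−1})·λ = B·(A^M − 1)/(A − 1) holds if and only if Z₄β⁴ + Z₃β³ + Z₂β² + Z₁β + Z₀ = 0. -/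
/-- The geometric sum `1 + x + ⋯ + x ^ (n - 1)` is smaller than `n` times its last term. -/
theorem geom_quotient_lt_natCast_mul_pow {x : ℝ} (hx : 1 < x) {n : ℕ} (hn : 2 ≤ n) :
    (x ^ n - 1) / (x - 1) < n * x ^ (n - 1) := by
  rw [← geom_sum_eq hx.ne']
  have h : ∑ i ∈ Finset.range n, x ^ i < ∑ _i ∈ Finset.range n, x ^ (n - 1) := by
    refine Finset.sum_lt_sum (fun i hi ↦ ?_) ⟨0, Finset.mem_range.2 (by omega), ?_⟩
    · exact pow_le_pow_right₀ hx.le (by have := Finset.mem_range.1 hi; omega)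
    · exact pow_lt_pow_right₀ hx (by omega)
  simpa using h

/-- Algebraic reduction of the eigenvalue fixed-point condition of the M-user time-varying
feedback code to a quartic equation in `β`: with `b = (1 − β√A)/(1 − a)`,
`λ = (β²(1 − A) − b²/P)/(ab(2(1 − a)b + Mab − 2))`, `B = b²/(Pβ²)` and
`C = A + (M/λ)(1 − A − B)`, one has `D_A ≠ 0` and
`(1 − CA^{M−1})λ = B(A^M − 1)/(A − 1)` iff `Z₄β⁴ + Z₃β³ + Z₂β² + Z₁β + Z₀ = 0`. -/
theorem stmt_19 (M : ℕ) (hM : 2 ≤ M) (a P A β : ℝ)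
    (ha0 : a ≠ 0) (ha1 : a ≠ 1) (hP : 0 < P) (hA : 1 < A) (hβ : 0 < β)
    (b : ℝ) (hb : b = (1 - β * Real.sqrt A) / (1 - a))
    (hab : a * b * (2 * (1 - a) * b + (M : ℝ) * a * b - 2) ≠ 0)
    (lam : ℝ)
    (hlam : lam = (β ^ 2 * (1 - A) - b ^ 2 / P) /
      (a * b * (2 * (1 - a) * b + (M : ℝ) * a * b - 2)))
    (hlam0 : lam ≠ 0)
    (B C : ℝ) (hB : B = b ^ 2 / (P * β ^ 2))
    (hC : C = A + ((M : ℝ) / lam) * (1 - A - B))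
    (DA : ℝ) (hDA : DA = -(M : ℝ) * A ^ (M - 1) + (A ^ M - 1) / (A - 1))
    (Y₀ Y₁ Y₂ : ℝ)
    (hY₀ : Y₀ = -((A ^ M - 1) * (A - 1)) / DA)
    (hY₁ : Y₁ = ((M : ℝ) * (A - 1) * A ^ (M - 1) / DA) * (2 * a))
    (hY₂ : Y₂ = -(A ^ M - 1) / (P * DA) -
      ((M : ℝ) * (A - 1) * A ^ (M - 1) / DA) * (a * (((M : ℝ) - 2) * a + 2)))
    (Z₄ Z₃ Z₂ Z₁ Z₀ : ℝ)
    (hZ₄ : Z₄ = Y₀ + A * Y₂ / (1 - a) ^ 2 +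
      a * (((M : ℝ) - 2) * a + 2) * A ^ 2 / (P * (1 - a) ^ 4))
    (hZ₃ : Z₃ = -4 * Real.sqrt A ^ 3 * (a * (((M : ℝ) - 2) * a + 2)) / (P * (1 - a) ^ 4) +
      2 * a * Real.sqrt A ^ 3 / (P * (1 - a) ^ 3) -
      2 * Y₂ * Real.sqrt A / (1 - a) ^ 2 - Y₁ * Real.sqrt A / (1 - a))
    (hZ₂ : Z₂ = 6 * A * (a * (((M : ℝ) - 2) * a + 2)) / (P * (1 - a) ^ 4) -
      6 * A * a / (P * (1 - a) ^ 3) + Y₂ / (1 - a) ^ 2 + Y₁ / (1 - a))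
    (hZ₁ : Z₁ = -4 * Real.sqrt A * (a * (((M : ℝ) - 2) * a + 2)) / (P * (1 - a) ^ 4) +
      6 * Real.sqrt A * a / (P * (1 - a) ^ 3))
    (hZ₀ : Z₀ = a * (((M : ℝ) - 2) * a + 2) / (P * (1 - a) ^ 4) -
      2 * a / (P * (1 - a) ^ 3)) :
    DA ≠ 0 ∧
    ((1 - C * A ^ (M - 1)) * lam = B * (A ^ M - 1) / (A - 1) ↔
      Z₄ * β ^ 4 + Z₃ * β ^ 3 + Z₂ * β ^ 2 + Z₁ * β + Z₀ = 0) := by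
  have hDA0 : DA ≠ 0 := by
    have := geom_quotient_lt_natCast_mul_pow hA hM
    rw [hDA]
    linarith
  refine ⟨hDA0, ?_⟩
  have h1a : 1 - a ≠ 0 := sub_ne_zero.2 ha1.symm
  have hpow : A ^ M = A * A ^ (M - 1) := (mul_pow_sub_one (by omega) A).symm
  have hsq : Real.sqrt A ^ 2 = A := Real.sq_sqrt (by linarith)
  have hsq4 : Real.sqrt A ^ 4 = A ^ 2 := by
    rw [← hsq]
    simp only [Real.sqrt_sq (Real.sqrt_nonneg A)]
    ring
  have hquartic : Z₄ * β ^ 4 + Z₃ * β ^ 3 + Z₂ * β ^ 2 + Z₁ * β + Z₀ =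
      (a * (((M : ℝ) - 2) * a + 2)) * b ^ 4 / P - 2 * a * b ^ 3 / P +
        Y₂ * b ^ 2 * β ^ 2 + Y₁ * b * β ^ 2 + Y₀ * β ^ 4 := by
    have hb2 : b ^ 2 = (1 - 2 * Real.sqrt A * β + A * β ^ 2) / (1 - a) ^ 2 := by
      rw [hb, div_pow]
      congr 1
      linear_combination β ^ 2 * hsq
    have hb3 : b ^ 3 = (1 - 3 * Real.sqrt A * β + 3 * A * β ^ 2 -
        Real.sqrt A ^ 3 * β ^ 3) / (1 - a) ^ 3 := by
      rw [hb, div_pow]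
      congr 1
      linear_combination 3 * β ^ 2 * hsq
    have hb4 : b ^ 4 = (1 - 4 * Real.sqrt A * β + 6 * A * β ^ 2 -
        4 * Real.sqrt A ^ 3 * β ^ 3 + A ^ 2 * β ^ 4) / (1 - a) ^ 4 := by
      rw [hb, div_pow]
      congr 1
      linear_combination 6 * β ^ 2 * hsq + β ^ 4 * hsq4
    rw [hb2, hb3, hb4, hb, hZ₄, hZ₃, hZ₂, hZ₁, hZ₀]
    field_simp
    ring
  set D := a * b * (2 * (1 - a) * b + (M : ℝ) * a * b - 2) with hD
  have hlamD : lam * D = β ^ 2 * (1 - A) - b ^ 2 / P := by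
    rw [hlam, div_mul_cancel₀ _ hab]
  have hBβ : B * β ^ 2 = b ^ 2 / P := by
    rw [hB]
    field_simp
  have hClam : C * lam = A * lam + M * (1 - A - B) := by
    rw [hC]
    field_simp
  have hS : (A ^ M - 1) / (A - 1) = DA + M * A ^ (M - 1) := by
    rw [hDA]
    ring
  have hY₀' : Y₀ * DA = -((A ^ M - 1) * (A - 1)) := by
    rw [hY₀, div_mul_cancel₀ _ hDA0]
  have hY₁' : Y₁ * DA = M * (A - 1) * A ^ (M - 1) * (2 * a) := by
    rw [hY₁]
    field_simp
  have hY₂' : Y₂ * DA = -(A ^ M - 1) / P -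
      M * (A - 1) * A ^ (M - 1) * (a * (((M : ℝ) - 2) * a + 2)) := by
    rw [hY₂]
    field_simp
  have key : D * β ^ 2 * (B * (A ^ M - 1) / (A - 1) - (1 - C * A ^ (M - 1)) * lam) =
      DA * (Z₄ * β ^ 4 + Z₃ * β ^ 3 + Z₂ * β ^ 2 + Z₁ * β + Z₀) := by
    rw [hquartic, mul_div_assoc, hS]
    rw [hpow] at hY₀' hY₂'
    linear_combination D * β ^ 2 * A ^ (M - 1) * hClam +
      β ^ 2 * (A * A ^ (M - 1) - 1) * hlamD + D * DA * hBβ +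
      DA * b ^ 2 / P * hD - M * (A - 1) * A ^ (M - 1) * β ^ 2 * hD -
      b ^ 2 * β ^ 2 * hY₂' - b * β ^ 2 * hY₁' - β ^ 4 * hY₀'
  have hDβ : D * β ^ 2 ≠ 0 := mul_ne_zero hab (pow_ne_zero 2 hβ.ne')
  rw [eq_comm, ← sub_eq_zero, ← mul_eq_zero_iff_left hDβ, key,
    mul_eq_zero_iff_left hDA0]
end
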